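/- arXiv:1511.06308 — 2 statements merged into one kernel-verified Lean document; each statement's English description precedes it below -/
import Mathlib

section
/- Let C be a plane external to the Klein quadric. For every 4-dimensional subspace T of ⋀²V with C ≤ T there exists a line M of P(V) with γM ≤ T (and then C + γM = T); moreover, any two lines M, N of P(V) with γM ≤ T and γN ≤ T are C-parallel. Hence the solids of P(⋀²V) through C correspond bijectively to the parallel classes of ∥_C. -/
open ExteriorAlgebra

variable (F : Type*) [Field F] (V : Type*) [AddCommGroup V] [Module F V]

/-- An element of the second exterior power `⋀²V` is decomposable if it is the wedge
`u ∧ v` of two vectors of `V`. -/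
def IsDecomposable (x : ⋀[F]^2 V) : Prop :=
  ∃ u v : V, (x : ExteriorAlgebra F V) = ι F u * ι F v

/-- A plane external to the Klein quadric: a 3-dimensional subspace of `⋀²V` containing
no nonzero decomposable element. -/
def IsExternalPlane (C : Submodule F ↥(⋀[F]^2 V)) : Prop :=
  Module.finrank F C = 3 ∧ ∀ x ∈ C, x ≠ 0 → ¬ IsDecomposable F V x

/-- The Plücker point `γM` of a line `M` of `P(V)`: the subspace of `⋀²V` spanned by all
wedges `u ∧ v` with `u, v ∈ M`.  For a 2-dimensional `M` this is the 1-dimensional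
subspace spanned by `u ∧ v`, where `{u, v}` is any basis of `M`. -/
def plueckerPoint (M : Submodule F V) : Submodule F ↥(⋀[F]^2 V) :=
  Submodule.span F {x : ⋀[F]^2 V | ∃ u ∈ M, ∃ v ∈ M, (x : ExteriorAlgebra F V) = ι F u * ι F v}

/-- The polar `X^⊥` of a subspace `X` of `⋀²V` with respect to the Klein quadric:
all `y` with `x ∧ y = 0` for every `x ∈ X`, the wedge being computed in the
exterior algebra of `V` (it lands in the 1-dimensional space `⋀⁴V`). -/
def polarSubspace (X : Submodule F ↥(⋀[F]^2 V)) : Submodule F ↥(⋀[F]^2 V) where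
  carrier := {y | ∀ x ∈ X, (x : ExteriorAlgebra F V) * (y : ExteriorAlgebra F V) = 0}
  add_mem' := by
    intro a b ha hb x hx
    rw [Submodule.coe_add, mul_add, ha x hx, hb x hx, add_zero]
  zero_mem' := by
    intro x hx
    simp
  smul_mem' := by
    intro c a ha x hx
    rw [Submodule.coe_smul, Algebra.mul_smul_comm, ha x hx, smul_zero]

variable {F V} in
theorem ι_mul_ι_mem_exteriorPower_two (u v : V) : ι F u * ι F v ∈ ⋀[F]^2 V := by
  simpa [ιMulti_apply] using (exteriorPower.ιMulti F 2 ![u, v]).2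

variable {F V} in
theorem ι_mul_ι_ne_zero_of_linearIndependent {u v : V} (h : LinearIndependent F ![u, v]) :
    ι F u * ι F v ≠ 0 := by
  intro h0
  obtain ⟨s⟩ : Nonempty (Set.powersetCard (Fin 2) 2) := ⟨⟨Finset.univ, by simp⟩⟩
  apply (exteriorPower.ιMulti_family_linearIndependent_field 2 h).ne_zero s
  have hlt := (Set.powersetCard.ofFinEmbEquiv.symm s).strictMono (show (0 : Fin 2) < 1 by decide)
  have e0 : Set.powersetCard.ofFinEmbEquiv.symm s 0 = 0 := by lia
  have e1 : Set.powersetCard.ofFinEmbEquiv.symm s 1 = 1 := by lia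
  apply Subtype.ext
  simpa [exteriorPower.ιMulti_family, ιMulti_apply, Matrix.vecTail, e0, e1] using h0

/-- The linear map `v ↦ e ∧ v` from `V` to `⋀²V`. -/
def wedgeLeft (e : V) : V →ₗ[F] ⋀[F]^2 V :=
  ((LinearMap.mulLeft F (ι F e)).comp (ι F)).codRestrict (⋀[F]^2 V)
    (ι_mul_ι_mem_exteriorPower_two e)

@[simp]
theorem coe_wedgeLeft (e v : V) :
    (wedgeLeft F V e v : ExteriorAlgebra F V) = ι F e * ι F v := rfl

theorem ker_wedgeLeft_le {e : V} (he : e ≠ 0) :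
    LinearMap.ker (wedgeLeft F V e) ≤ Submodule.span F {e} := by
  intro v hv
  by_contra hmem
  refine ι_mul_ι_ne_zero_of_linearIndependent (F := F) (u := e) (v := v) ?_ ?_
  · rw [LinearIndependent.pair_iff' he]
    exact fun a ha => hmem (Submodule.mem_span_singleton.2 ⟨a, ha⟩)
  · rw [← coe_wedgeLeft, LinearMap.mem_ker.1 hv, Submodule.coe_zero]

theorem finrank_le_finrank_range_wedgeLeft [FiniteDimensional F V] {e : V} (he : e ≠ 0) :
    Module.finrank F V ≤ Module.finrank F (LinearMap.range (wedgeLeft F V e)) + 1 := by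
  have h := LinearMap.finrank_range_add_finrank_ker (wedgeLeft F V e)
  have hk := Submodule.finrank_mono (ker_wedgeLeft_le F V he)
  rw [finrank_span_singleton he] at hk
  lia

theorem plueckerPoint_span_pair_le (u v : V) :
    plueckerPoint F V (Submodule.span F {u, v}) ≤ Submodule.span F {wedgeLeft F V u v} := by
  refine Submodule.span_le.2 ?_
  rintro x ⟨p, hp, q, hq, hx⟩
  obtain ⟨a, b, rfl⟩ := Submodule.mem_span_pair.1 hp
  obtain ⟨c, d, rfl⟩ := Submodule.mem_span_pair.1 hq
  refine Submodule.mem_span_singleton.2 ⟨a * d - b * c, Subtype.ext ?_⟩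
  have hs : ι F v * ι F u = -(ι F u * ι F v) :=
    eq_neg_of_add_eq_zero_left (ι_add_mul_swap v u)
  simp only [Submodule.coe_smul, coe_wedgeLeft, hx, map_add, map_smul, add_mul, mul_add,
    smul_mul_smul_comm, ι_sq_zero, hs]
  module

theorem exists_wedgeLeft_mem_ne_zero [FiniteDimensional F V] (hV : Module.finrank F V = 4)
    (T : Submodule F ↥(⋀[F]^2 V)) (hT : Module.finrank F T = 4) :
    ∃ u v : V, wedgeLeft F V u v ∈ T ∧ wedgeLeft F V u v ≠ 0 := by
  have : Nontrivial V := Module.nontrivial_of_finrank_pos (R := F) (by lia)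
  obtain ⟨e, he⟩ := exists_ne (0 : V)
  have hr := finrank_le_finrank_range_wedgeLeft F V he
  have hd : Module.finrank F ↥(⋀[F]^2 V) = 6 := by
    rw [exteriorPower.finrank_eq, hV]
    rfl
  have hs := Submodule.finrank_sup_add_finrank_inf_eq T (LinearMap.range (wedgeLeft F V e))
  have hle := (T ⊔ LinearMap.range (wedgeLeft F V e)).finrank_le
  have hne : T ⊓ LinearMap.range (wedgeLeft F V e) ≠ ⊥ := fun h => by
    rw [h, finrank_bot] at hs
    lia
  obtain ⟨x, ⟨hxT, v, rfl⟩, hx⟩ := Submodule.exists_mem_ne_zero_of_ne_bot hne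
  exact ⟨e, v, hxT, hx⟩

theorem finrank_span_pair_of_wedgeLeft_ne_zero {u v : V} (h : wedgeLeft F V u v ≠ 0) :
    Module.finrank F (Submodule.span F {u, v}) = 2 := by
  have hu : u ≠ 0 := by
    rintro rfl
    exact h (Subtype.ext (by simp))
  have hli : LinearIndependent F ![u, v] := by
    rw [LinearIndependent.pair_iff' hu]
    rintro a rfl
    exact h (Subtype.ext (by simp))
  rw [← Matrix.range_cons_cons_empty u v ![], finrank_span_eq_card hli, Fintype.card_fin]

theorem exists_wedgeLeft_mem_plueckerPoint {M : Submodule F V} (hM : Module.finrank F M = 2) :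
    ∃ u v : V, wedgeLeft F V u v ∈ plueckerPoint F V M ∧ wedgeLeft F V u v ≠ 0 := by
  have : FiniteDimensional F M := Module.finite_of_finrank_pos (by lia)
  let b := Module.finBasisOfFinrankEq F M hM
  have hli : LinearIndependent F ![(b 0 : V), (b 1 : V)] := by
    have h : M.subtype ∘ b = ![(b 0 : V), (b 1 : V)] := by
      ext i
      fin_cases i <;> rfl
    exact h ▸ b.linearIndependent.map' M.subtype M.ker_subtype
  refine ⟨b 0, b 1, Submodule.subset_span ⟨_, (b 0).2, _, (b 1).2, rfl⟩, fun h => ?_⟩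
  exact ι_mul_ι_ne_zero_of_linearIndependent hli (congrArg Subtype.val h)

variable {F V} in
theorem IsExternalPlane.sup_plueckerPoint_eq [FiniteDimensional F V]
    {C T : Submodule F ↥(⋀[F]^2 V)} (hC : IsExternalPlane F V C)
    (hT : Module.finrank F T = 4) (hCT : C ≤ T) {M : Submodule F V}
    (hM : Module.finrank F M = 2) (hMT : plueckerPoint F V M ≤ T) :
    C ⊔ plueckerPoint F V M = T := by
  refine Submodule.eq_of_le_of_finrank_le (sup_le hCT hMT) ?_
  obtain ⟨u, v, hmem, hne⟩ := exists_wedgeLeft_mem_plueckerPoint F V hM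
  have hlt : C < C ⊔ plueckerPoint F V M :=
    lt_of_le_of_ne le_sup_left fun h =>
      hC.2 _ (h ▸ (le_sup_right : plueckerPoint F V M ≤ C ⊔ plueckerPoint F V M) hmem) hne
        ⟨u, v, rfl⟩
  have := Submodule.finrank_lt_finrank_of_lt hlt
  have := hC.1
  lia

/-- For a plane `C` external to the Klein quadric, every solid `T` through `C` contains the
Plücker point of some line `M` (and then `C + γM = T`), and any two lines with Plücker
points in `T` are `C`-parallel.  Hence solids through `C` correspond bijectively to the
parallel classes of `∥_C`. -/
theorem solids_through_C_biject_with_parallel_classes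
    [FiniteDimensional F V] (hV : Module.finrank F V = 4)
    (C : Submodule F ↥(⋀[F]^2 V)) (hC : IsExternalPlane F V C) :
    ∀ T : Submodule F ↥(⋀[F]^2 V), Module.finrank F T = 4 → C ≤ T →
      (∃ M : Submodule F V, Module.finrank F M = 2 ∧ plueckerPoint F V M ≤ T ∧
        C ⊔ plueckerPoint F V M = T) ∧
      ∀ M N : Submodule F V, Module.finrank F M = 2 → Module.finrank F N = 2 →
        plueckerPoint F V M ≤ T → plueckerPoint F V N ≤ T →
          C ⊔ plueckerPoint F V M = C ⊔ plueckerPoint F V N := by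
  intro T hT hCT
  refine ⟨?_, fun M N hM hN hMT hNT => ?_⟩
  · obtain ⟨u, v, hmem, hne⟩ := exists_wedgeLeft_mem_ne_zero F V hV T hT
    have hM := finrank_span_pair_of_wedgeLeft_ne_zero F V hne
    have hMT : plueckerPoint F V (Submodule.span F {u, v}) ≤ T :=
      (plueckerPoint_span_pair_le F V u v).trans
        ((Submodule.span_singleton_le_iff_mem _ _).2 hmem)
    exact ⟨_, hM, hMT, hC.sup_plueckerPoint_eq hT hCT hM hMT⟩
  · rw [hC.sup_plueckerPoint_eq hT hCT hM hMT, hC.sup_plueckerPoint_eq hT hCT hN hNT]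
end

section
/- Let ∥ be a parallelism of P(V). Then the following are equivalent: (1) there exists a plane C external to the Klein quadric such that for all lines M, N one has M ∥ N if and only if C + γM = C + γN (i.e., ∥ is Clifford); (2) for any two lines M, N with M not parallel to N there exists a 5-dimensional subspace W of ⋀²V such that γX ≤ W for every line X with X ∥ M or X ∥ N (any two distinct parallel classes are contained in a common linear complex, i.e., a geometric hyperplane of the Grassmann space); (3) for any two lines M, N with M not parallel to N there is a unique such 5-dimensional subspace W, and moreover W = {y ∈ ⋀²V : x₀ ∧ y = 0} for some non-decomposable x₀ ∈ ⋀²V (the linear complex is general). -/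
open ExteriorAlgebra

variable (F : Type*) [Field F] (V : Type*) [AddCommGroup V] [Module F V]

section Wedge

variable {F V}

/-- The wedge product of vectors, as a bilinear map into `⋀²V`. -/
def wedge : V →ₗ[F] V →ₗ[F] ⋀[F]^2 V :=
  LinearMap.mk₂ F
    (fun u v ↦ ⟨ι F u * ι F v, by
      simpa using (exteriorPower.ιMulti F 2 ![u, v]).2⟩)
    (fun _ _ _ ↦ Subtype.ext (by simp [add_mul]))
    (fun _ _ _ ↦ Subtype.ext (by simp))
    (fun _ _ _ ↦ Subtype.ext (by simp [mul_add]))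
    (fun _ _ _ ↦ Subtype.ext (by simp))

@[simp]
lemma coe_wedge (u v : V) :
    (wedge (F := F) u v : ExteriorAlgebra F V) = ι F u * ι F v := rfl

@[simp]
lemma wedge_self (u : V) : wedge (F := F) u u = 0 :=
  Subtype.ext (by simp)

lemma wedge_swap (u v : V) : wedge (F := F) u v = -wedge v u := by
  have h := wedge_self (F := F) (u + v)
  simp only [map_add, LinearMap.add_apply, wedge_self, zero_add, add_zero] at h
  exact eq_neg_of_add_eq_zero_right h

lemma span_wedge :
    Submodule.span F {x : ⋀[F]^2 V | ∃ u v, x = wedge u v} = ⊤ := by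
  rw [← exteriorPower.ιMulti_span]
  congr 1
  ext x
  constructor
  · rintro ⟨u, v, rfl⟩
    exact ⟨![u, v], Subtype.ext (by simp)⟩
  · rintro ⟨a, rfl⟩
    exact ⟨a 0, a 1, Subtype.ext (by simp [ExteriorAlgebra.ιMulti_apply, Matrix.vecTail])⟩

lemma hom_ext_wedge {N : Type*} [AddCommGroup N] [Module F N] {f g : ⋀[F]^2 V →ₗ[F] N}
    (h : ∀ u v, f (wedge u v) = g (wedge u v)) : f = g :=
  LinearMap.ext_on span_wedge (by rintro _ ⟨u, v, rfl⟩; exact h u v)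

lemma exists_apply_wedge_ne_zero {φ : Module.Dual F (⋀[F]^2 V)} (hφ : φ ≠ 0) :
    ∃ u v, φ (wedge u v) ≠ 0 := by
  by_contra! h
  exact hφ (hom_ext_wedge (by simpa using h))

lemma apply_wedge_swap {φ : Module.Dual F (⋀[F]^2 V)} {u v : V}
    (h : φ (wedge u v) = 0) : φ (wedge v u) = 0 := by
  rw [wedge_swap, map_neg, h, neg_zero]

lemma isDecomposable_iff {x : ⋀[F]^2 V} :
    IsDecomposable F V x ↔ ∃ u v, x = wedge u v :=
  exists_congr fun _ ↦ exists_congr fun _ ↦ by rw [Subtype.ext_iff, coe_wedge]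

lemma linearIndependent_of_wedge_ne_zero {u v : V} (h : wedge (F := F) u v ≠ 0) :
    LinearIndependent F ![u, v] := by
  have hu : u ≠ 0 := by rintro rfl; simp at h
  rw [LinearIndependent.pair_iff' hu]
  rintro a rfl
  simp at h

lemma iMulti_ne_zero {n : ℕ} {v : Fin n → V} (h : LinearIndependent F v) :
    exteriorPower.ιMulti F n v ≠ 0 := by
  let s := Set.powersetCard.ofFinEmbEquiv (n := n) (RelEmbedding.refl (· ≤ ·) : Fin n ↪o Fin n)
  have := (exteriorPower.ιMulti_family_linearIndependent_field n h).ne_zero s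
  simpa [exteriorPower.ιMulti_family, s] using this

lemma wedge_ne_zero {u v : V} (h : LinearIndependent F ![u, v]) :
    wedge (F := F) u v ≠ 0 := by
  have := iMulti_ne_zero h
  contrapose! this
  exact Subtype.ext (by simpa using congrArg Subtype.val this)

lemma finrank_span_pair {u v : V} (h : LinearIndependent F ![u, v]) :
    Module.finrank F (Submodule.span F {u, v}) = 2 := by
  have := finrank_span_eq_card h
  rwa [Matrix.range_cons_cons_empty, Fintype.card_fin] at this

lemma exists_basis_of_mem {M : Submodule F V} (hM : Module.finrank F M = 2) {u : V}
    (hu : u ∈ M) (hu0 : u ≠ 0) :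
    ∃ v, LinearIndependent F ![u, v] ∧ M = Submodule.span F {u, v} := by
  have : FiniteDimensional F M := .of_finrank_pos (by lia)
  obtain ⟨v, hv, hvu⟩ : ∃ v ∈ M, v ∉ Submodule.span F {u} := by
    by_contra! h
    have := Submodule.finrank_mono (t := Submodule.span F {u}) h
    rw [finrank_span_singleton hu0] at this
    lia
  have hli : LinearIndependent F ![u, v] := by
    rw [LinearIndependent.pair_iff' hu0]
    rintro a rfl
    exact hvu (Submodule.smul_mem _ _ (Submodule.mem_span_singleton_self u))
  refine ⟨v, hli, (Submodule.eq_of_le_of_finrank_eq ?_ ?_).symm⟩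
  · simp [Submodule.span_le, Set.insert_subset_iff, hu, hv]
  · rw [finrank_span_pair hli, hM]

lemma exists_mem_ne_zero {M : Submodule F V} (hM : Module.finrank F M = 2) :
    ∃ u ∈ M, u ≠ 0 :=
  Submodule.exists_mem_ne_zero_of_ne_bot (by rintro rfl; simp at hM)

lemma plueckerPoint_span_pair (u v : V) :
    plueckerPoint F V (Submodule.span F {u, v}) = Submodule.span F {wedge u v} := by
  apply le_antisymm
  · refine Submodule.span_le.2 ?_
    rintro x ⟨a, ha, b, hb, hx⟩
    obtain rfl : x = wedge a b := Subtype.ext hx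
    obtain ⟨a₁, a₂, rfl⟩ := Submodule.mem_span_pair.1 ha
    obtain ⟨b₁, b₂, rfl⟩ := Submodule.mem_span_pair.1 hb
    refine Submodule.mem_span_singleton.2 ⟨a₁ * b₂ - a₂ * b₁, ?_⟩
    simp only [map_add, map_smul, LinearMap.add_apply, LinearMap.smul_apply, wedge_self,
      wedge_swap v u]
    module
  · rw [Submodule.span_singleton_le_iff_mem]
    exact Submodule.subset_span
      ⟨u, Submodule.subset_span (by simp), v, Submodule.subset_span (by simp), rfl⟩

lemma plueckerPoint_le_iff {X : Submodule F V} {W : Submodule F (⋀[F]^2 V)} :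
    plueckerPoint F V X ≤ W ↔ ∀ u ∈ X, ∀ v ∈ X, wedge u v ∈ W := by
  rw [plueckerPoint, Submodule.span_le]
  constructor
  · exact fun h u hu v hv ↦ h ⟨u, hu, v, hv, rfl⟩
  · rintro h x ⟨u, hu, v, hv, hx⟩
    obtain rfl : x = wedge u v := Subtype.ext hx
    exact h u hu v hv

lemma finrank_exteriorPower_two [FiniteDimensional F V] (hV : Module.finrank F V = 4) :
    Module.finrank F (⋀[F]^2 V) = 6 := by
  rw [exteriorPower.finrank_eq, hV]; rfl

lemma hom_ext_wedge_basis {I : Type*} [LinearOrder I] (b : Module.Basis I F V) {N : Type*}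
    [AddCommGroup N] [Module F N] {f g : ⋀[F]^2 V →ₗ[F] N}
    (h : ∀ i j, i < j → f (wedge (b i) (b j)) = g (wedge (b i) (b j))) : f = g := by
  refine hom_ext_wedge fun u v ↦ ?_
  suffices wedge.compr₂ f = wedge.compr₂ g from LinearMap.congr_fun₂ this u v
  refine b.ext fun i ↦ b.ext fun j ↦ ?_
  rcases lt_trichotomy i j with hij | rfl | hij
  · exact h i j hij
  · simp
  · simp only [LinearMap.compr₂_apply]
    rw [wedge_swap, map_neg, map_neg, h j i hij]

/-- Given `φ`, the element of `⋀²V` representing it with respect to the basis `a, b, c, d`. -/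
def representative (φ : Module.Dual F (⋀[F]^2 V)) (a b c d : V) : ⋀[F]^2 V :=
  φ (wedge a b) • wedge c d - φ (wedge a c) • wedge b d + φ (wedge a d) • wedge b c +
    φ (wedge b c) • wedge a d - φ (wedge b d) • wedge a c + φ (wedge c d) • wedge a b

lemma representative_mul (φ : Module.Dual F (⋀[F]^2 V)) (a b c d : V) :
    ∀ p ∈ [(a, b), (a, c), (a, d), (b, c), (b, d), (c, d)],
      (representative φ a b c d : ExteriorAlgebra F V) * (ι F p.1 * ι F p.2) =
        φ (wedge p.1 p.2) • (ι F a * (ι F b * (ι F c * ι F d))) := by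
  have hsq (u : V) (z : ExteriorAlgebra F V) : ι F u * (ι F u * z) = 0 := by
    rw [← mul_assoc, ι_sq_zero, zero_mul]
  have hsw (u v : V) : ι F u * ι F v = -(ι F v * ι F u) :=
    eq_neg_of_add_eq_zero_left (ι_add_mul_swap u v)
  have hsw' (u v : V) (z : ExteriorAlgebra F V) :
      ι F u * (ι F v * z) = -(ι F v * (ι F u * z)) := by
    rw [← mul_assoc, hsw, neg_mul, mul_assoc]
  simp [representative, add_mul, sub_mul, mul_assoc, hsq, hsw c b, hsw d b, hsw d c,
    hsw' b a, hsw' c a, hsw' d a, hsw' c b, hsw' d b, hsw' d c]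

/-- Every linear form on `⋀²V` is, up to the identification of `⋀⁴V` with `F`, the wedge
product with some element of `⋀²V`. -/
lemma exists_mul_eq_zero_iff [FiniteDimensional F V] (hV : Module.finrank F V = 4)
    (φ : Module.Dual F (⋀[F]^2 V)) :
    ∃ x₀ : ⋀[F]^2 V, ∀ y : ⋀[F]^2 V,
      (x₀ : ExteriorAlgebra F V) * (y : ExteriorAlgebra F V) = 0 ↔ φ y = 0 := by
  let b := Module.finBasisOfFinrankEq F V hV
  let ω : ExteriorAlgebra F V := ι F (b 0) * (ι F (b 1) * (ι F (b 2) * ι F (b 3)))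
  have hω : ω ≠ 0 := by
    have := iMulti_ne_zero b.linearIndependent
    contrapose! this
    exact Subtype.ext (by
      simpa [ExteriorAlgebra.ιMulti_apply, List.ofFn_succ, Matrix.vecTail] using this)
  let x₀ := representative φ (b 0) (b 1) (b 2) (b 3)
  have key : LinearMap.mulLeft F (x₀ : ExteriorAlgebra F V) ∘ₗ (⋀[F]^2 V).subtype =
      φ.smulRight ω := by
    refine hom_ext_wedge_basis b fun i j hij ↦
      representative_mul φ (b 0) (b 1) (b 2) (b 3) (b i, b j) ?_
    have hmem : ∀ i j : Fin 4, i < j →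
        (i, j) ∈ [(0, 1), (0, 2), (0, 3), (1, 2), (1, 3), (2, 3)] := by decide
    exact List.mem_map_of_mem (f := Prod.map b b) (hmem i j hij)
  refine ⟨x₀, fun y ↦ ?_⟩
  have h : (x₀ : ExteriorAlgebra F V) * (y : ExteriorAlgebra F V) = φ y • ω :=
    LinearMap.congr_fun key y
  rw [h, smul_eq_zero_iff_left hω]

lemma exists_eq_ker [FiniteDimensional F V] (hV : Module.finrank F V = 4)
    {W : Submodule F (⋀[F]^2 V)} (hW : Module.finrank F W = 5) :
    ∃ φ : Module.Dual F (⋀[F]^2 V), φ ≠ 0 ∧ W = LinearMap.ker φ := by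
  have hΛ := finrank_exteriorPower_two hV
  have hlt : W < ⊤ := lt_top_iff_ne_top.2 (by rintro rfl; rw [finrank_top] at hW; lia)
  obtain ⟨φ, hφ, hle⟩ := Submodule.exists_le_ker_of_lt_top W hlt
  refine ⟨φ, hφ, Submodule.eq_of_le_of_finrank_eq hle ?_⟩
  have := Module.Dual.finrank_ker_add_one_of_ne_zero hφ
  lia

/-- Joining an external plane with a Plücker point gives a 4-dimensional subspace. -/
lemma IsExternalPlane.finrank_sup_plueckerPoint [FiniteDimensional F V]
    {C : Submodule F (⋀[F]^2 V)} (hC : IsExternalPlane F V C) {M : Submodule F V}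
    (hM : Module.finrank F M = 2) :
    Module.finrank F (C ⊔ plueckerPoint F V M : Submodule F (⋀[F]^2 V)) = 4 := by
  obtain ⟨u, hu, hu0⟩ := exists_mem_ne_zero hM
  obtain ⟨v, hli, rfl⟩ := exists_basis_of_mem hM hu hu0
  rw [plueckerPoint_span_pair]
  have hw := wedge_ne_zero hli
  have hd : C ⊓ Submodule.span F {wedge u v} = ⊥ := by
    rw [← disjoint_iff, Submodule.disjoint_span_singleton' hw]
    exact fun h ↦ hC.2 _ h hw (isDecomposable_iff.2 ⟨u, v, rfl⟩)
  have := Submodule.finrank_sup_add_finrank_inf_eq C (Submodule.span F {wedge u v})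
  rw [hd, finrank_bot, finrank_span_singleton hw, hC.1] at this
  exact this

end Wedge

/-- The hypothesis that `P` is a parallelism of `P(V)`, as a relation on lines. -/
structure IsParallelism (P : Submodule F V → Submodule F V → Prop) : Prop where
  finrank_eq : ∀ M N, P M N → Module.finrank F M = 2 ∧ Module.finrank F N = 2
  refl : ∀ M : Submodule F V, Module.finrank F M = 2 → P M M
  symm : ∀ M N, P M N → P N M
  trans : ∀ L M N, P L M → P M N → P L N
  existsUnique : ∀ p M : Submodule F V, Module.finrank F p = 1 → Module.finrank F M = 2 →
    ∃! N : Submodule F V, Module.finrank F N = 2 ∧ p ≤ N ∧ P N M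

section Parallelism

variable {F V}

/-- The linear forms on `⋀²V` that vanish on the Plücker points of all lines parallel
to `M`; equivalently, the alternating bilinear forms for which all these lines are isotropic. -/
def classForms (P : Submodule F V → Submodule F V → Prop) (M : Submodule F V) :
    Submodule F (Module.Dual F (⋀[F]^2 V)) :=
  (⨆ (X : Submodule F V) (_ : P X M), plueckerPoint F V X).dualAnnihilator

/-- Any two distinct parallel classes admit a common nonzero form. -/
def ClassesMeet (P : Submodule F V → Submodule F V → Prop) : Prop :=
  ∀ M N : Submodule F V, Module.finrank F M = 2 → Module.finrank F N = 2 →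
    ¬ P M N → classForms P M ⊓ classForms P N ≠ ⊥

lemma mem_classForms {P : Submodule F V → Submodule F V → Prop} {M : Submodule F V}
    {φ : Module.Dual F (⋀[F]^2 V)} :
    φ ∈ classForms P M ↔ ∀ X, P X M → plueckerPoint F V X ≤ LinearMap.ker φ := by
  rw [classForms, Submodule.mem_dualAnnihilator]
  change _ ≤ LinearMap.ker φ ↔ _
  simp

lemma apply_wedge_of_mem_classForms {P : Submodule F V → Submodule F V → Prop}
    {M X : Submodule F V} {φ : Module.Dual F (⋀[F]^2 V)} (hφ : φ ∈ classForms P M)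
    (hX : P X M) {u v : V} (hu : u ∈ X) (hv : v ∈ X) : φ (wedge u v) = 0 :=
  plueckerPoint_le_iff.1 (mem_classForms.1 hφ X hX) u hu v hv

lemma finrank_dualAnnihilator_line [FiniteDimensional F V]
    (hV : Module.finrank F V = 4) {X : Submodule F V}
    (hX : Module.finrank F X = 2) :
    Module.finrank F X.dualAnnihilator = 2 := by
  have := Subspace.finrank_add_finrank_dualAnnihilator_eq X
  lia

/-- If parallelism is described by an external plane, then two classes lie in a common
linear complex. -/
lemma IsExternalPlane.exists_common_complex [FiniteDimensional F V]
    {P : Submodule F V → Submodule F V → Prop} {C : Submodule F (⋀[F]^2 V)}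
    (hC : IsExternalPlane F V C)
    (h : ∀ M N : Submodule F V, Module.finrank F M = 2 → Module.finrank F N = 2 →
      (P M N ↔ C ⊔ plueckerPoint F V M = C ⊔ plueckerPoint F V N))
    {M N : Submodule F V} (hM : Module.finrank F M = 2) (hN : Module.finrank F N = 2)
    (hMN : ¬ P M N) :
    ∃ W : Submodule F (⋀[F]^2 V), Module.finrank F W = 5 ∧
      ∀ X : Submodule F V, Module.finrank F X = 2 → (P X M ∨ P X N) →
        plueckerPoint F V X ≤ W := by
  have hM4 := hC.finrank_sup_plueckerPoint hM
  have hN4 := hC.finrank_sup_plueckerPoint hN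
  have hne := mt (h M N hM hN).2 hMN
  refine ⟨(C ⊔ plueckerPoint F V M) ⊔ (C ⊔ plueckerPoint F V N), ?_, ?_⟩
  · have hadd := Submodule.finrank_sup_add_finrank_inf_eq
      (C ⊔ plueckerPoint F V M) (C ⊔ plueckerPoint F V N)
    have h3 : 3 ≤ Module.finrank F
        ((C ⊔ plueckerPoint F V M) ⊓ (C ⊔ plueckerPoint F V N) : Submodule F _) :=
      hC.1.symm.trans_le (Submodule.finrank_mono (le_inf le_sup_left le_sup_left))
    have hle := Submodule.finrank_mono (inf_le_left :
      (C ⊔ plueckerPoint F V M) ⊓ (C ⊔ plueckerPoint F V N) ≤ C ⊔ plueckerPoint F V M)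
    have h4 : Module.finrank F
        ((C ⊔ plueckerPoint F V M) ⊓ (C ⊔ plueckerPoint F V N) : Submodule F _) ≠ 4 := by
      intro h4
      exact hne ((Submodule.eq_of_le_of_finrank_eq inf_le_left (h4.trans hM4.symm)).symm.trans
        (Submodule.eq_of_le_of_finrank_eq inf_le_right (h4.trans hN4.symm)))
    lia
  · rintro X hX (hXM | hXN)
    · exact (le_sup_right.trans ((h X M hX hM).1 hXM).le).trans le_sup_left
    · exact (le_sup_right.trans ((h X N hX hN).1 hXN).le).trans le_sup_right

namespace IsParallelism

variable {P : Submodule F V → Submodule F V → Prop}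

lemma exists_line (hP : IsParallelism F V P)
    {M : Submodule F V} (hM : Module.finrank F M = 2) {p : V} (hp : p ≠ 0) :
    ∃ X, P X M ∧ p ∈ X := by
  obtain ⟨X, ⟨-, hX, hXM⟩, -⟩ :=
    hP.existsUnique (Submodule.span F {p}) M (finrank_span_singleton hp) hM
  exact ⟨X, hXM, (Submodule.span_singleton_le_iff_mem _ _).1 hX⟩

lemma eq_of_mem (hP : IsParallelism F V P)
    {M X Y : Submodule F V} (hX : P X M) (hY : P Y M) {p : V} (hp : p ≠ 0)
    (hpX : p ∈ X) (hpY : p ∈ Y) : X = Y :=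
  (hP.existsUnique (Submodule.span F {p}) M (finrank_span_singleton hp)
    (hP.finrank_eq _ _ hX).2).unique
    ⟨(hP.finrank_eq _ _ hX).1, (Submodule.span_singleton_le_iff_mem _ _).2 hpX, hX⟩
    ⟨(hP.finrank_eq _ _ hY).1, (Submodule.span_singleton_le_iff_mem _ _).2 hpY, hY⟩

lemma classForms_congr (hP : IsParallelism F V P)
    {M N : Submodule F V} (h : P M N) : classForms P M = classForms P N := by
  ext φ
  simp only [mem_classForms]
  exact ⟨fun H X hX ↦ H X (hP.trans _ _ _ hX (hP.symm _ _ h)),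
    fun H X hX ↦ H X (hP.trans _ _ _ hX h)⟩

lemma exists_not_parallel (hP : IsParallelism F V P)
    (hV : Module.finrank F V = 4) {M : Submodule F V} (hM : Module.finrank F M = 2) :
    ∃ N : Submodule F V, Module.finrank F N = 2 ∧ ¬ P N M := by
  obtain ⟨p, hpM, hp⟩ := exists_mem_ne_zero hM
  obtain ⟨q, hq⟩ : ∃ q, q ∉ M := by
    by_contra! h
    rw [(Submodule.eq_top_iff'.2 h), finrank_top] at hM
    lia
  have hli : LinearIndependent F ![p, q] := by
    rw [LinearIndependent.pair_iff' hp]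
    rintro a rfl
    exact hq (M.smul_mem a hpM)
  refine ⟨_, finrank_span_pair hli, fun h ↦ hq ?_⟩
  rw [← hP.eq_of_mem h (hP.refl M hM) hp (Submodule.subset_span (by simp)) hpM]
  exact Submodule.subset_span (by simp)

lemma exists_classForms_not_mem (hP : IsParallelism F V P)
    {φ : Module.Dual F (⋀[F]^2 V)} (hφ : φ ≠ 0) :
    ∃ K : Submodule F V, Module.finrank F K = 2 ∧ φ ∉ classForms P K := by
  obtain ⟨u, v, huv⟩ := exists_apply_wedge_ne_zero hφ
  have hw : wedge (F := F) u v ≠ 0 := by rintro h; simp [h] at huv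
  have hK := finrank_span_pair (linearIndependent_of_wedge_ne_zero hw)
  exact ⟨_, hK, fun h ↦ huv (apply_wedge_of_mem_classForms h (hP.refl _ hK)
    (Submodule.subset_span (by simp)) (Submodule.subset_span (by simp)))⟩

lemma forall_le_ker_iff (hP : IsParallelism F V P)
    {M N : Submodule F V} {φ : Module.Dual F (⋀[F]^2 V)} :
    (∀ X : Submodule F V, Module.finrank F X = 2 → (P X M ∨ P X N) →
      plueckerPoint F V X ≤ LinearMap.ker φ) ↔ φ ∈ classForms P M ⊓ classForms P N := by
  rw [Submodule.mem_inf, mem_classForms, mem_classForms]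
  exact ⟨fun h ↦ ⟨fun X hX ↦ h X (hP.finrank_eq _ _ hX).1 (.inl hX),
    fun X hX ↦ h X (hP.finrank_eq _ _ hX).1 (.inr hX)⟩,
    fun h X _ hX ↦ hX.elim (h.1 X) (h.2 X)⟩

variable [FiniteDimensional F V]

lemma sup_eq_top (hP : IsParallelism F V P) (hV : Module.finrank F V = 4)
    {M X Y : Submodule F V} (hX : P X M) (hY : P Y M) (h : X ≠ Y) :
    X ⊔ Y = ⊤ := by
  have hd : X ⊓ Y = ⊥ := by
    by_contra h0
    obtain ⟨p, hp, hp0⟩ := Submodule.exists_mem_ne_zero_of_ne_bot h0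
    exact h (hP.eq_of_mem hX hY hp0 hp.1 hp.2)
  have := Submodule.finrank_sup_add_finrank_inf_eq X Y
  rw [hd, finrank_bot, (hP.finrank_eq _ _ hX).1, (hP.finrank_eq _ _ hY).1] at this
  exact Submodule.eq_top_of_finrank_eq (by lia)

/-- A point off an isotropic line `X` of a parallel class that is orthogonal to `X` is
in the radical. -/
lemma apply_wedge_eq_zero (hP : IsParallelism F V P) (hV : Module.finrank F V = 4)
    {M X : Submodule F V} {φ : Module.Dual F (⋀[F]^2 V)}
    (hφ : φ ∈ classForms P M) (hX : P X M) {t : V} (ht : t ∉ X)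
    (h : ∀ x ∈ X, φ (wedge t x) = 0) (q : V) : φ (wedge t q) = 0 := by
  have ht0 : t ≠ 0 := by rintro rfl; exact ht X.zero_mem
  obtain ⟨Y, hY, htY⟩ := hP.exists_line (hP.finrank_eq _ _ hX).2 ht0
  have hq : q ∈ X ⊔ Y := by
    rw [hP.sup_eq_top hV hX hY (by rintro rfl; exact ht htY)]
    trivial
  obtain ⟨x, hx, y, hy, rfl⟩ := Submodule.mem_sup.1 hq
  rw [map_add, map_add, h x hx, apply_wedge_of_mem_classForms hφ hY htY hy, add_zero]

/-- A nonzero alternating form for which all lines of a parallel class are isotropic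
is nondegenerate. -/
lemma eq_zero_of_radical (hP : IsParallelism F V P) (hV : Module.finrank F V = 4)
    {M : Submodule F V} (hM : Module.finrank F M = 2)
    {φ : Module.Dual F (⋀[F]^2 V)}
    (hφ : φ ∈ classForms P M) {p : V} (hp : p ≠ 0) (h : ∀ q, φ (wedge p q) = 0) : φ = 0 := by
  obtain ⟨X, hX, hpX⟩ := hP.exists_line hM hp
  obtain ⟨p', -, hXs⟩ := exists_basis_of_mem (hP.finrank_eq _ _ hX).1 hpX hp
  have hp' : p' ∈ X := by rw [hXs]; exact Submodule.subset_span (by simp)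
  have key : ∀ t ∉ X, φ (wedge p' t) = 0 → ∀ q, φ (wedge t q) = 0 := by
    intro t ht htp'
    refine hP.apply_wedge_eq_zero hV hφ hX ht fun x hx ↦ ?_
    rw [hXs] at hx
    obtain ⟨a, b, rfl⟩ := Submodule.mem_span_pair.1 hx
    simp [apply_wedge_swap (h t), apply_wedge_swap htp']
  have hp'rad : ∀ q, φ (wedge p' q) = 0 := by
    obtain ⟨t, ht, htX⟩ : ∃ t, φ (wedge p' t) = 0 ∧ t ∉ X := by
      by_contra! hle
      have h1 := Submodule.finrank_mono (s := LinearMap.ker (φ ∘ₗ wedge p')) (t := X) hle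
      have h2 := (φ ∘ₗ wedge p').finrank_range_add_finrank_ker
      have h3 := Submodule.finrank_le (LinearMap.range (φ ∘ₗ wedge p'))
      rw [(hP.finrank_eq _ _ hX).1] at h1
      rw [Module.finrank_self] at h3
      lia
    intro q
    have h1 := key t htX ht q
    have h2 := key (t + p') (fun hm ↦ htX (by simpa using X.sub_mem hm hp')) (by simp [ht]) q
    simpa [h1] using h2
  refine hom_ext_wedge fun r q ↦ ?_
  by_cases hr : r ∈ X
  · rw [hXs] at hr
    obtain ⟨a, b, rfl⟩ := Submodule.mem_span_pair.1 hr
    simp [h, hp'rad]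
  · exact key r hr (hp'rad r) q

/-- Pairing with a point `p` sends the forms vanishing on a class injectively to the
functionals vanishing on the line of the class through `p`. -/
lemma exists_injective_eval (hP : IsParallelism F V P) (hV : Module.finrank F V = 4)
    {M X : Submodule F V} (hX : P X M) {p : V} (hpX : p ∈ X)
    (hp : p ≠ 0) :
    ∃ f : classForms P M →ₗ[F] X.dualAnnihilator, Function.Injective f ∧
      ∀ φ q, (f φ : Module.Dual F V) q = φ.1 (wedge p q) := by
  refine ⟨LinearMap.codRestrict _
    (LinearMap.lcomp F F (wedge p) ∘ₗ (classForms P M).subtype) fun φ ↦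
      (Submodule.mem_dualAnnihilator _).2 fun _ hx ↦
        apply_wedge_of_mem_classForms φ.2 hX hpX hx, ?_, fun _ _ ↦ rfl⟩
  rw [injective_iff_map_eq_zero]
  intro φ hφ
  refine Subtype.ext (hP.eq_zero_of_radical hV (hP.finrank_eq _ _ hX).2 φ.2 hp fun q ↦ ?_)
  exact LinearMap.congr_fun (congrArg Subtype.val hφ) q

lemma finrank_classForms_le (hP : IsParallelism F V P) (hV : Module.finrank F V = 4)
    {M : Submodule F V} (hM : Module.finrank F M = 2) :
    Module.finrank F (classForms P M) ≤ 2 := by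
  obtain ⟨p, hpM, hp⟩ := exists_mem_ne_zero hM
  obtain ⟨f, hf, -⟩ := hP.exists_injective_eval hV (hP.refl M hM) hpM hp
  exact (LinearMap.finrank_le_finrank_of_injective hf).trans_eq
    (finrank_dualAnnihilator_line hV hM)

lemma mem_of_forall_apply_wedge_eq_zero (hP : IsParallelism F V P) (hV : Module.finrank F V = 4)
    {M X : Submodule F V}
    (h2 : Module.finrank F (classForms P M) = 2) (hX : P X M) {p q : V} (hpX : p ∈ X)
    (hp : p ≠ 0) (h : ∀ φ ∈ classForms P M, φ (wedge p q) = 0) : q ∈ X := by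
  obtain ⟨f, hf, hfe⟩ := hP.exists_injective_eval hV hX hpX hp
  have h2' := finrank_dualAnnihilator_line hV (hP.finrank_eq _ _ hX).1
  have hsurj := (LinearMap.injective_iff_surjective_of_finrank_eq_finrank
    (V := classForms P M) (V₂ := X.dualAnnihilator) (h2.trans h2'.symm)).1 hf
  rw [← Subspace.forall_mem_dualAnnihilator_apply_eq_zero_iff]
  intro ψ hψ
  obtain ⟨φ, hφ⟩ := hsurj ⟨ψ, hψ⟩
  have := hfe φ q
  rw [hφ, h _ φ.2] at this
  exact this

lemma parallel_of_plueckerPoint_le (hP : IsParallelism F V P) (hV : Module.finrank F V = 4)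
    {M N : Submodule F V} (hM : Module.finrank F M = 2)
    (h2 : Module.finrank F (classForms P M) = 2) (hN : Module.finrank F N = 2)
    (h : plueckerPoint F V N ≤ (classForms P M).dualCoannihilator) : P N M := by
  obtain ⟨p, hpN, hp⟩ := exists_mem_ne_zero hN
  obtain ⟨X, hX, hpX⟩ := hP.exists_line hM hp
  have hNX : N ≤ X := fun q hq ↦
    hP.mem_of_forall_apply_wedge_eq_zero hV h2 hX hpX hp fun φ hφ ↦
      (Submodule.mem_dualCoannihilator _).1 (plueckerPoint_le_iff.1 h p hpN q hq) φ hφ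
  rwa [Submodule.eq_of_le_of_finrank_eq hNX (hN.trans (hP.finrank_eq _ _ hX).1.symm)]

lemma finrank_classForms (hP : IsParallelism F V P) (hV : Module.finrank F V = 4)
    (hH : ClassesMeet P)
    {M : Submodule F V} (hM : Module.finrank F M = 2) :
    Module.finrank F (classForms P M) = 2 := by
  refine (hP.finrank_classForms_le hV hM).antisymm ?_
  obtain ⟨N, hN, hNM⟩ := hP.exists_not_parallel hV hM
  obtain ⟨φ, hφ, hφ0⟩ := Submodule.exists_mem_ne_zero_of_ne_bot (hH N M hN hM hNM)
  obtain ⟨K, hK, hφK⟩ := hP.exists_classForms_not_mem hφ0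
  have hKM : ¬ P K M := fun h ↦ hφK (by rw [hP.classForms_congr h]; exact hφ.2)
  obtain ⟨ψ, hψ, hψ0⟩ := Submodule.exists_mem_ne_zero_of_ne_bot (hH K M hK hM hKM)
  have hli : LinearIndependent F ![ψ, φ] := by
    rw [LinearIndependent.pair_iff' hψ0]
    rintro a rfl
    exact hφK (Submodule.smul_mem _ _ hψ.1)
  refine (finrank_span_pair hli).symm.trans_le (Submodule.finrank_mono ?_)
  simp [Submodule.span_le, Set.insert_subset_iff, hφ.2, hψ.2]

lemma finrank_classForms_inf (hP : IsParallelism F V P) (hV : Module.finrank F V = 4)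
    (hH : ClassesMeet P)
    {M N : Submodule F V} (hM : Module.finrank F M = 2)
    (hN : Module.finrank F N = 2) (hMN : ¬ P M N) :
    Module.finrank F (classForms P M ⊓ classForms P N : Submodule F _) = 1 := by
  have hM2 := hP.finrank_classForms hV hH hM
  have hN2 := hP.finrank_classForms hV hH hN
  have h0 : Module.finrank F (classForms P M ⊓ classForms P N : Submodule F _) ≠ 0 := by
    rw [Ne, Submodule.finrank_eq_zero]
    exact hH M N hM hN hMN
  have hle := Submodule.finrank_mono
    (inf_le_left : classForms P M ⊓ classForms P N ≤ classForms P M)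
  suffices Module.finrank F (classForms P M ⊓ classForms P N : Submodule F _) ≠ 2 by lia
  intro h2
  refine hMN (hP.parallel_of_plueckerPoint_le hV hN hN2 hM ?_)
  rw [← Submodule.eq_of_le_of_finrank_eq inf_le_right (h2.trans hN2.symm)]
  refine plueckerPoint_le_iff.2 fun u hu v hv ↦ (Submodule.mem_dualCoannihilator _).2 fun φ hφ ↦ ?_
  exact apply_wedge_of_mem_classForms hφ.1 (hP.refl M hM) hu hv

lemma classForms_le_of_mem (hP : IsParallelism F V P) (hV : Module.finrank F V = 4)
    (hH : ClassesMeet P)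
    {M N : Submodule F V} (hM : Module.finrank F M = 2)
    (hN : Module.finrank F N = 2) (hMN : ¬ P M N)
    {D : Submodule F (Module.Dual F (⋀[F]^2 V))} (hMD : classForms P M ≤ D) {φ}
    (hφD : φ ∈ D) (hφN : φ ∈ classForms P N) (hφM : φ ∉ classForms P M) :
    classForms P N ≤ D := by
  obtain ⟨ψ, hψ, hψ0⟩ := Submodule.exists_mem_ne_zero_of_ne_bot (hH M N hM hN hMN)
  have hli : LinearIndependent F ![ψ, φ] := by
    rw [LinearIndependent.pair_iff' hψ0]
    rintro a rfl
    exact hφM (Submodule.smul_mem _ _ hψ.1)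
  rw [← Submodule.eq_of_le_of_finrank_eq (S₁ := Submodule.span F {ψ, φ})
    (S₂ := classForms P N) (by simp [Submodule.span_le, Set.insert_subset_iff, hφN, hψ.2])
    ((finrank_span_pair hli).trans (hP.finrank_classForms hV hH hN).symm)]
  simp [Submodule.span_le, Set.insert_subset_iff, hφD, hMD hψ.1]

lemma exists_smul_eq (hP : IsParallelism F V P) (hV : Module.finrank F V = 4)
    (hH : ClassesMeet P)
    {M N : Submodule F V} (hM : Module.finrank F M = 2)
    (hN : Module.finrank F N = 2) (hMN : ¬ P M N) {φ ψ : Module.Dual F (⋀[F]^2 V)}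
    (hφ : φ ∈ classForms P M ⊓ classForms P N) (hφ0 : φ ≠ 0)
    (hψ : ψ ∈ classForms P M ⊓ classForms P N) : ∃ c : F, c • φ = ψ := by
  obtain ⟨c, hc⟩ := exists_smul_eq_of_finrank_eq_one
    (V := (classForms P M ⊓ classForms P N : Submodule F _))
    (hP.finrank_classForms_inf hV hH hM hN hMN) (x := ⟨φ, hφ⟩) (by simpa using hφ0) ⟨ψ, hψ⟩
  exact ⟨c, congrArg Subtype.val hc⟩

lemma classForms_le_sup (hP : IsParallelism F V P) (hV : Module.finrank F V = 4)
    (hH : ClassesMeet P)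
    {M N L : Submodule F V} (hM : Module.finrank F M = 2)
    (hN : Module.finrank F N = 2) (hL : Module.finrank F L = 2) (hMN : ¬ P M N)
    {φ : Module.Dual F (⋀[F]^2 V)} (hφ : φ ∈ classForms P M ⊓ classForms P N) (hφ0 : φ ≠ 0)
    (hφL : φ ∉ classForms P L) : classForms P L ≤ classForms P M ⊔ classForms P N := by
  have hML : ¬ P M L := fun h ↦ hφL (by rw [← hP.classForms_congr h]; exact hφ.1)
  have hNL : ¬ P N L := fun h ↦ hφL (by rw [← hP.classForms_congr h]; exact hφ.2)
  obtain ⟨ψ, hψ, hψ0⟩ := Submodule.exists_mem_ne_zero_of_ne_bot (hH N L hN hL hNL)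
  refine hP.classForms_le_of_mem hV hH hM hL hML le_sup_left (φ := ψ)
    ((le_sup_right : _ ≤ classForms P M ⊔ classForms P N) hψ.1) hψ.2 fun h ↦ ?_
  obtain ⟨c, rfl⟩ := hP.exists_smul_eq hV hH hM hN hMN hφ hφ0 ⟨h, hψ.1⟩
  exact hφL ((Submodule.smul_mem_iff _ (left_ne_zero_of_smul hψ0)).1 hψ.2)

/-- All classes of the parallelism have their forms in a common 3-dimensional space. -/
lemma exists_forall_classForms_le (hP : IsParallelism F V P) (hV : Module.finrank F V = 4)
    (hH : ClassesMeet P) :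
    ∃ D : Submodule F (Module.Dual F (⋀[F]^2 V)),
    Module.finrank F D = 3 ∧ ∀ M : Submodule F V, Module.finrank F M = 2 →
      classForms P M ≤ D := by
  have : Nontrivial V := Module.nontrivial_of_finrank_pos (R := F) (by lia)
  obtain ⟨u, hu⟩ := exists_ne (0 : V)
  obtain ⟨v, huv⟩ := exists_linearIndependent_pair_of_one_lt_finrank (R := F) (by lia) hu
  have hM := finrank_span_pair huv
  generalize Submodule.span F {u, v} = M at hM
  obtain ⟨N, hN, hNM⟩ := hP.exists_not_parallel hV hM
  have hMN := mt (hP.symm M N) hNM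
  obtain ⟨φ, hφ, hφ0⟩ := Submodule.exists_mem_ne_zero_of_ne_bot (hH M N hM hN hMN)
  obtain ⟨K, hK, hφK⟩ := hP.exists_classForms_not_mem hφ0
  refine ⟨classForms P M ⊔ classForms P N, ?_, fun L hL ↦ ?_⟩
  · have := Submodule.finrank_sup_add_finrank_inf_eq (classForms P M) (classForms P N)
    rw [hP.finrank_classForms_inf hV hH hM hN hMN, hP.finrank_classForms hV hH hM,
      hP.finrank_classForms hV hH hN] at this
    lia
  by_cases hφL : φ ∈ classForms P L
  · have hKL : ¬ P K L := fun h ↦ hφK (by rwa [hP.classForms_congr h])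
    exact hP.classForms_le_of_mem hV hH hK hL hKL
      (hP.classForms_le_sup hV hH hM hN hK hMN hφ hφ0 hφK)
      ((le_sup_left : _ ≤ classForms P M ⊔ classForms P N) hφ.1) hφL hφK
  · exact hP.classForms_le_sup hV hH hM hN hL hMN hφ hφ0 hφL

lemma exists_isExternalPlane (hP : IsParallelism F V P) (hV : Module.finrank F V = 4)
    (hH : ClassesMeet P) :
    ∃ C : Submodule F (⋀[F]^2 V), IsExternalPlane F V C ∧
      ∀ M N : Submodule F V, Module.finrank F M = 2 → Module.finrank F N = 2 →
        (P M N ↔ C ⊔ plueckerPoint F V M = C ⊔ plueckerPoint F V N) := by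
  obtain ⟨D, hD, hle⟩ := hP.exists_forall_classForms_le hV hH
  have hΛ := finrank_exteriorPower_two hV
  have hCle : ∀ M : Submodule F V, Module.finrank F M = 2 →
      D.dualCoannihilator ≤ (classForms P M).dualCoannihilator := fun M hM ↦
    Submodule.dualCoannihilator_anti (hle M hM)
  have hC : IsExternalPlane F V D.dualCoannihilator := by
    refine ⟨?_, fun x hx hx0 hdec ↦ ?_⟩
    · exact Nat.add_left_cancel ((congrArg (· + _) hD.symm).trans
        ((Subspace.finrank_add_finrank_dualCoannihilator_eq D).trans hΛ) : 3 + _ = 3 + 3)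
    · obtain ⟨u, v, rfl⟩ := isDecomposable_iff.1 hdec
      have hX := finrank_span_pair (linearIndependent_of_wedge_ne_zero hx0)
      obtain ⟨N, hN, hNX⟩ := hP.exists_not_parallel hV hX
      refine hNX (hP.symm _ _ (hP.parallel_of_plueckerPoint_le hV hN
        (hP.finrank_classForms hV hH hN) hX ?_))
      rw [plueckerPoint_span_pair, Submodule.span_singleton_le_iff_mem]
      exact hCle N hN hx
  have hsup : ∀ M : Submodule F V, Module.finrank F M = 2 →
      D.dualCoannihilator ⊔ plueckerPoint F V M = (classForms P M).dualCoannihilator := by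
    intro M hM
    refine Submodule.eq_of_le_of_finrank_eq (sup_le (hCle M hM) ?_) ?_
    · refine plueckerPoint_le_iff.2 fun u hu v hv ↦
        (Submodule.mem_dualCoannihilator _).2 fun φ hφ ↦ ?_
      exact apply_wedge_of_mem_classForms hφ (hP.refl M hM) hu hv
    · have := Subspace.finrank_add_finrank_dualCoannihilator_eq (classForms P M)
      rw [hP.finrank_classForms hV hH hM] at this
      rw [hC.finrank_sup_plueckerPoint hM]
      lia
  refine ⟨_, hC, fun M N hM hN ↦ ⟨fun h ↦ ?_, fun h ↦ ?_⟩⟩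
  · rw [hsup M hM, hsup N hN, hP.classForms_congr h]
  · refine hP.parallel_of_plueckerPoint_le hV hN (hP.finrank_classForms hV hH hN) hM ?_
    rw [← hsup N hN, ← h]
    exact le_sup_right

lemma linearComplex_unique (hP : IsParallelism F V P) (hV : Module.finrank F V = 4)
    (hH : ClassesMeet P)
    {M N : Submodule F V} (hM : Module.finrank F M = 2)
    (hN : Module.finrank F N = 2) (hMN : ¬ P M N) {W W' : Submodule F (⋀[F]^2 V)}
    (hW : Module.finrank F W = 5) (hW' : Module.finrank F W' = 5)
    (h : ∀ X : Submodule F V, Module.finrank F X = 2 → (P X M ∨ P X N) →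
      plueckerPoint F V X ≤ W)
    (h' : ∀ X : Submodule F V, Module.finrank F X = 2 → (P X M ∨ P X N) →
      plueckerPoint F V X ≤ W') : W = W' := by
  obtain ⟨φ, hφ0, rfl⟩ := exists_eq_ker hV hW
  obtain ⟨ψ, hψ0, rfl⟩ := exists_eq_ker hV hW'
  rw [hP.forall_le_ker_iff] at h h'
  obtain ⟨c, rfl⟩ := hP.exists_smul_eq hV hH hM hN hMN h hφ0 h'
  exact (LinearMap.ker_smul φ c (left_ne_zero_of_smul hψ0)).symm

/-- A linear complex containing a parallel class is general. -/
lemma exists_not_isDecomposable (hP : IsParallelism F V P) (hV : Module.finrank F V = 4)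
    {M : Submodule F V} (hM : Module.finrank F M = 2)
    {φ : Module.Dual F (⋀[F]^2 V)} (hφ : φ ∈ classForms P M) (hφ0 : φ ≠ 0) :
    ∃ x₀ : ⋀[F]^2 V, ¬ IsDecomposable F V x₀ ∧ ∀ y : ⋀[F]^2 V,
      y ∈ LinearMap.ker φ ↔ (x₀ : ExteriorAlgebra F V) * (y : ExteriorAlgebra F V) = 0 := by
  obtain ⟨x₀, hx₀⟩ := exists_mul_eq_zero_iff hV φ
  refine ⟨x₀, fun hdec ↦ hφ0 ?_, fun y ↦ by rw [LinearMap.mem_ker, hx₀]⟩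
  obtain ⟨u, v, rfl⟩ := isDecomposable_iff.1 hdec
  by_cases hu : u = 0
  · subst hu
    exact LinearMap.ext fun y ↦ (hx₀ y).1 (by simp)
  · refine hP.eq_zero_of_radical hV hM hφ hu fun q ↦ (hx₀ _).1 ?_
    rw [wedge_swap u v]
    simp [mul_assoc, ← mul_assoc (ι F u) (ι F u)]

end IsParallelism

end Parallelism
/-- A parallelism of `P(V)` is Clifford (induced by a plane external to the Klein quadric)
iff any two distinct parallel classes lie in a common geometric hyperplane (linear complex)
of the Grassmann space, iff any two distinct parallel classes lie in a unique linear
complex, which is moreover general. -/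
theorem clifford_iff_hyperplanes
    [FiniteDimensional F V] (hV : Module.finrank F V = 4)
    (P : Submodule F V → Submodule F V → Prop)
    (hrel : ∀ M N : Submodule F V, P M N → Module.finrank F M = 2 ∧ Module.finrank F N = 2)
    (hrefl : ∀ M : Submodule F V, Module.finrank F M = 2 → P M M)
    (hsymm : ∀ M N : Submodule F V, P M N → P N M)
    (htrans : ∀ L M N : Submodule F V, P L M → P M N → P L N)
    (hpar : ∀ p M : Submodule F V, Module.finrank F p = 1 → Module.finrank F M = 2 →
      ∃! N : Submodule F V, Module.finrank F N = 2 ∧ p ≤ N ∧ P N M) :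
    ((∃ C : Submodule F ↥(⋀[F]^2 V), IsExternalPlane F V C ∧
        ∀ M N : Submodule F V, Module.finrank F M = 2 → Module.finrank F N = 2 →
          (P M N ↔ C ⊔ plueckerPoint F V M = C ⊔ plueckerPoint F V N)) ↔
      (∀ M N : Submodule F V, Module.finrank F M = 2 → Module.finrank F N = 2 → ¬ P M N →
        ∃ W : Submodule F ↥(⋀[F]^2 V), Module.finrank F W = 5 ∧
          ∀ X : Submodule F V, Module.finrank F X = 2 → (P X M ∨ P X N) →
            plueckerPoint F V X ≤ W)) ∧
    ((∀ M N : Submodule F V, Module.finrank F M = 2 → Module.finrank F N = 2 → ¬ P M N →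
        ∃ W : Submodule F ↥(⋀[F]^2 V), Module.finrank F W = 5 ∧
          ∀ X : Submodule F V, Module.finrank F X = 2 → (P X M ∨ P X N) →
            plueckerPoint F V X ≤ W) ↔
      (∀ M N : Submodule F V, Module.finrank F M = 2 → Module.finrank F N = 2 → ¬ P M N →
        (∃! W : Submodule F ↥(⋀[F]^2 V), Module.finrank F W = 5 ∧
          ∀ X : Submodule F V, Module.finrank F X = 2 → (P X M ∨ P X N) →
            plueckerPoint F V X ≤ W) ∧
        ∀ W : Submodule F ↥(⋀[F]^2 V),
          (Module.finrank F W = 5 ∧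
            ∀ X : Submodule F V, Module.finrank F X = 2 → (P X M ∨ P X N) →
              plueckerPoint F V X ≤ W) →
          ∃ x₀ : ⋀[F]^2 V, ¬ IsDecomposable F V x₀ ∧
            ∀ y : ⋀[F]^2 V,
              y ∈ W ↔ (x₀ : ExteriorAlgebra F V) * (y : ExteriorAlgebra F V) = 0)) := by
  have hP : IsParallelism F V P := ⟨hrel, hrefl, hsymm, htrans, hpar⟩
  have hforms (hW : ∀ M N : Submodule F V, Module.finrank F M = 2 → Module.finrank F N = 2 →
      ¬ P M N → ∃ W : Submodule F ↥(⋀[F]^2 V), Module.finrank F W = 5 ∧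
        ∀ X : Submodule F V, Module.finrank F X = 2 → (P X M ∨ P X N) →
          plueckerPoint F V X ≤ W) :
      ClassesMeet P := by
    intro M N hM hN hMN
    obtain ⟨W, hW5, hle⟩ := hW M N hM hN hMN
    obtain ⟨φ, hφ0, rfl⟩ := exists_eq_ker hV hW5
    exact Submodule.ne_bot_iff _ |>.2 ⟨φ, hP.forall_le_ker_iff.1 hle, hφ0⟩
  refine ⟨⟨?_, fun h ↦ hP.exists_isExternalPlane hV (hforms h)⟩, fun h M N hM hN hMN ↦ ⟨?_, ?_⟩,
    fun h M N hM hN hMN ↦ (h M N hM hN hMN).1.exists⟩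
  · rintro ⟨C, hC, h⟩ M N hM hN hMN
    exact hC.exists_common_complex h hM hN hMN
  · obtain ⟨W, hW⟩ := h M N hM hN hMN
    exact ⟨W, hW, fun W' hW' ↦
      hP.linearComplex_unique hV (hforms h) hM hN hMN hW'.1 hW.1 hW'.2 hW.2⟩
  · rintro W ⟨hW5, hle⟩
    obtain ⟨φ, hφ0, rfl⟩ := exists_eq_ker hV hW5
    exact hP.exists_not_isDecomposable hV hM (hP.forall_le_ker_iff.1 hle).1 hφ0
end
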